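/- arXiv:2601.06934 — 3 statements merged into one kernel-verified Lean document; each statement's English description precedes it below -/
import Mathlib

section
/- Let G₁ be an OE-group and H, K finite subgroups of G₁. Then the cardinality of the quotient of Iso(H,K) by the orbit equivalence relation of Γ̄_{HK} equals the cardinality of the quotient of Iso(H,K) by the equivalence relation identifying f and f₁ whenever HNN(G₁,H,K,f) and HNN(G₁,H,K,f₁) are isomorphic; in other words, the number of isomorphism classes of the groups HNN(G₁,H,K,f), as f ranges over Iso(H,K), equals the number of Γ̄_{HK}-orbits on Iso(H,K). -/
universe u w

/-- The restriction to a subgroup `H` of an automorphism of `G` that leaves `H`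
invariant. -/
def restrAut {G : Type u} [Group G] (H : Subgroup G) (α : G ≃* G)
    (hα : ∀ x : G, x ∈ H ↔ α x ∈ H) : H ≃* H where
  toFun x := ⟨α x, (hα x).mp x.2⟩
  invFun x := ⟨α.symm x, (hα _).mpr (by simp)⟩
  left_inv x := by ext; simp
  right_inv x := by ext; simp
  map_mul' x y := by ext; simp

/-- The automorphism `x ↦ g·α(x)·g⁻¹` of a subgroup `K` invariant under it. -/
def conjAut {G : Type u} [Group G] (K : Subgroup G) (g : G) (α : G ≃* G)
    (hK : ∀ x : G, x ∈ K ↔ g * α x * g⁻¹ ∈ K) : K ≃* K where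
  toFun x := ⟨g * α x * g⁻¹, (hK x).mp x.2⟩
  invFun x := ⟨α.symm (g⁻¹ * x * g), (hK _).mpr (by simp [mul_assoc])⟩
  left_inv x := by ext; simp [mul_assoc]
  right_inv x := by ext; simp [mul_assoc]
  map_mul' x y := by ext; simp [mul_assoc]

/-- The permutation of `Iso(H,K)` induced by an element `(g,α)` of `Γ_{HK}`, i.e. a pair
with `α(H) = H` and `g·α(K)·g⁻¹ = K`.  It sends `f` to `h ↦ g·α(f(α⁻¹(h)))·g⁻¹`. -/
def gammaPerm {G : Type u} [Group G] (H K : Subgroup G) (g : G) (α : G ≃* G)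
    (hα : ∀ x : G, x ∈ H ↔ α x ∈ H)
    (hK : ∀ x : G, x ∈ K ↔ g * α x * g⁻¹ ∈ K) : Equiv.Perm (H ≃* K) where
  toFun f := ((restrAut H α hα).symm.trans f).trans (conjAut K g α hK)
  invFun f := ((restrAut H α hα).trans f).trans (conjAut K g α hK).symm
  left_inv f := by ext x; simp
  right_inv f := by ext x; simp

/-- `Γ̃_{HK}`: the image in `Sym(Iso(H,K))` of the stabilizer `Γ_{HK}`, i.e. the set of the
permutations `gammaPerm` induced by pairs `(g,α)` with `α(H) = H` and `g·α(K)·g⁻¹ = K`. -/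
def gammaTildeSet {G : Type u} [Group G] (H K : Subgroup G) : Set (Equiv.Perm (H ≃* K)) :=
  {σ | ∃ (g : G) (α : G ≃* G) (hα : ∀ x : G, x ∈ H ↔ α x ∈ H)
      (hK : ∀ x : G, x ∈ K ↔ g * α x * g⁻¹ ∈ K), σ = gammaPerm H K g α hα hK}

/-- The isomorphism `H ≃ K` obtained by restricting an automorphism `ψ` of `G` with
`ψ(H) = K`. -/
def restrMap {G : Type u} [Group G] (H K : Subgroup G) (ψ : G ≃* G)
    (h1 : ∀ x : G, x ∈ H ↔ ψ x ∈ K) : H ≃* K where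
  toFun x := ⟨ψ x, (h1 x).mp x.2⟩
  invFun y := ⟨ψ.symm y, (h1 _).mpr (by simp)⟩
  left_inv x := by ext; simp
  right_inv y := by ext; simp
  map_mul' x y := by ext; simp

/-- The isomorphism `H ≃ K`, `x ↦ ψ⁻¹(g₁⁻¹·x·g₁)`, coming from swapping data `(ψ,g₁)`
(where `ψ(K) = g₁⁻¹·H·g₁`, i.e. `∀ x, x ∈ K ↔ g₁·ψ(x)·g₁⁻¹ ∈ H`). -/
def dMap {G : Type u} [Group G] (H K : Subgroup G) (ψ : G ≃* G) (g₁ : G)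
    (h2 : ∀ x : G, x ∈ K ↔ g₁ * ψ x * g₁⁻¹ ∈ H) : H ≃* K where
  toFun x := ⟨ψ.symm (g₁⁻¹ * x * g₁), (h2 _).mpr (by simp [mul_assoc])⟩
  invFun y := ⟨g₁ * ψ y * g₁⁻¹, (h2 _).mp y.2⟩
  left_inv x := by ext; simp [mul_assoc]
  right_inv y := by ext; simp [mul_assoc]
  map_mul' x y := by ext; simp [mul_assoc]

/-- The permutation `ι_{ψ,g₁}` of `Iso(H,K)` attached to swapping data `(ψ,g₁)` for `(H,K)`
(i.e. `ψ(H) = K` and `ψ(K) = g₁⁻¹·H·g₁`): it sends `f` to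
`h ↦ ψ⁻¹(g₁⁻¹·f⁻¹(ψ(h))·g₁)`. -/
def iotaPerm {G : Type u} [Group G] (H K : Subgroup G) (ψ : G ≃* G) (g₁ : G)
    (h1 : ∀ x : G, x ∈ H ↔ ψ x ∈ K)
    (h2 : ∀ x : G, x ∈ K ↔ g₁ * ψ x * g₁⁻¹ ∈ H) : Equiv.Perm (H ≃* K) where
  toFun f := ((restrMap H K ψ h1).trans f.symm).trans (dMap H K ψ g₁ h2)
  invFun f := ((dMap H K ψ g₁ h2).trans f.symm).trans (restrMap H K ψ h1)
  left_inv f := by ext x; simp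
  right_inv f := by ext x; simp

/-- A group has the tree fixed-point property if every action of it without inversions
(given by a homomorphism to the permutations of the vertices preserving adjacency) on a
tree (a nonempty connected acyclic simple graph) in which all edge stabilizers are finite
fixes a vertex. -/
def TreeFixedPointProperty (Γ : Type*) [Group Γ] : Prop :=
  ∀ (V : Type w) (T : SimpleGraph V), T.IsTree →
    ∀ ρ : Γ →* Equiv.Perm V,
      (∀ (g : Γ) (x y : V), T.Adj x y → T.Adj (ρ g x) (ρ g y)) →
      (¬ ∃ (g : Γ) (x y : V), T.Adj x y ∧ ρ g x = y ∧ ρ g y = x) →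
      (∀ x y : V, T.Adj x y → Set.Finite {g : Γ | ρ g x = x ∧ ρ g y = y}) →
      ∃ v : V, ∀ g : Γ, ρ g v = v

/-- A group is residually finite if every nontrivial element is nontrivial in some finite
quotient. -/
def ResiduallyFinite (G : Type*) [Group G] : Prop :=
  ∀ g : G, g ≠ 1 → ∃ (Q : Type) (_ : Group Q), Finite Q ∧ ∃ φ : G →* Q, φ g ≠ 1

/-- An OE-group: a finitely generated, residually finite group with the tree fixed-point
property. -/
def IsOEGroup (Γ : Type*) [Group Γ] : Prop :=
  Group.FG Γ ∧ ResiduallyFinite Γ ∧ TreeFixedPointProperty.{w} Γ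

/-- The set of permutations `ι_{ψ,g₁}` of `Iso(H,K)` for all swapping data `(ψ,g₁)`
for `(H,K)`. -/
def iotaSet {G : Type u} [Group G] (H K : Subgroup G) : Set (Equiv.Perm (H ≃* K)) :=
  {σ | ∃ (ψ : G ≃* G) (g₁ : G) (h1 : ∀ x : G, x ∈ H ↔ ψ x ∈ K)
      (h2 : ∀ x : G, x ∈ K ↔ g₁ * ψ x * g₁⁻¹ ∈ H), σ = iotaPerm H K ψ g₁ h1 h2}

/-- `Γ̄_{HK}`: the subgroup of `Sym(Iso(H,K))` generated by `Γ̃_{HK}` together with the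
permutations `ι_{ψ,g₁}` for all swapping data `(ψ,g₁)` for `(H,K)`. -/
def gammaBar {G : Type u} [Group G] (H K : Subgroup G) : Subgroup (Equiv.Perm (H ≃* K)) :=
  Subgroup.closure (gammaTildeSet H K ∪ iotaSet H K)

namespace SimpleGraph

variable {V : Type*} {T : SimpleGraph V} {x y z a b : V}

theorem IsTree.eq_of_adj_of_dist_add_one_eq (hT : T.IsTree) (ha : T.Adj x a) (hb : T.Adj x b)
    (hda : T.dist a y + 1 = T.dist x y) (hdb : T.dist b y + 1 = T.dist x y) : a = b := by
  obtain ⟨p, hp⟩ := hT.connected.exists_walk_length_eq_dist a y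
  obtain ⟨q, hq⟩ := hT.connected.exists_walk_length_eq_dist b y
  have hp' : (Walk.cons ha p).IsPath := Walk.isPath_of_length_eq_dist _ (by simp [hp, hda])
  have hq' : (Walk.cons hb q).IsPath := Walk.isPath_of_length_eq_dist _ (by simp [hq, hdb])
  simpa using congrArg (fun r : T.Path x y => (r : T.Walk x y).snd)
    ((hT.isAcyclic.subsingleton_path x y).elim ⟨_, hp'⟩ ⟨_, hq'⟩)

theorem IsTree.exists_adj_dist_add_one_eq (hT : T.IsTree) (h : x ≠ y) :
    ∃ a, T.Adj x a ∧ T.dist a y + 1 = T.dist x y := by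
  obtain ⟨p, hp⟩ := hT.connected.exists_walk_length_eq_dist x y
  cases p with
  | nil => exact absurd rfl h
  | @cons _ a _ hxa p =>
    refine ⟨a, hxa, ?_⟩
    have h1 := dist_le p
    have h2 : T.dist x y ≤ T.dist x a + T.dist a y := hT.connected.dist_triangle
    rw [dist_eq_one_iff_adj.mpr hxa] at h2
    rw [Walk.length_cons] at hp
    omega

open Classical in
/-- The first vertex after `x` on the geodesic from `x` to `y` in a tree (and `x` itself when
`x = y`). -/
noncomputable def stepToward (T : SimpleGraph V) (x y : V) : V :=
  if h : ∃ a, T.Adj x a ∧ T.dist a y + 1 = T.dist x y then h.choose else x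

theorem IsTree.adj_stepToward (hT : T.IsTree) (h : x ≠ y) : T.Adj x (T.stepToward x y) := by
  have := hT.exists_adj_dist_add_one_eq h
  rw [stepToward, dif_pos this]
  exact this.choose_spec.1

theorem IsTree.dist_stepToward (hT : T.IsTree) (h : x ≠ y) :
    T.dist (T.stepToward x y) y + 1 = T.dist x y := by
  have := hT.exists_adj_dist_add_one_eq h
  rw [stepToward, dif_pos this]
  exact this.choose_spec.2

theorem IsTree.eq_stepToward (hT : T.IsTree) (ha : T.Adj x a)
    (hd : T.dist a y + 1 = T.dist x y) : a = T.stepToward x y := by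
  have h : x ≠ y := by rintro rfl; simp at hd
  exact hT.eq_of_adj_of_dist_add_one_eq ha (hT.adj_stepToward h) hd (hT.dist_stepToward h)

theorem IsTree.dist_eq_add_one_of_ne_stepToward (hT : T.IsTree) (ha : T.Adj x a)
    (hne : a ≠ T.stepToward x y) : T.dist a y = T.dist x y + 1 := by
  rcases hT.dist_eq_dist_add_one_of_adj y ha with h | h
  · exact absurd (hT.eq_stepToward ha (by rw [dist_comm, ← h, dist_comm])) hne
  · rw [dist_comm, h, dist_comm]

/-- Shortening a geodesic at one end does not change it at the other end. -/
theorem IsTree.stepToward_stepToward (hT : T.IsTree) (hxy : x ≠ y)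
    (hay : T.stepToward x y ≠ y) :
    T.stepToward y (T.stepToward x y) = T.stepToward y x := by
  have ha := hT.adj_stepToward hxy
  have hd := hT.dist_stepToward hxy
  set a := T.stepToward x y
  have hb := hT.adj_stepToward (Ne.symm hay)
  have hbd := hT.dist_stepToward (Ne.symm hay)
  set b := T.stepToward y a
  by_contra hbx
  have h1 := hT.dist_eq_add_one_of_ne_stepToward hb hbx
  have h2 : T.dist b x ≤ T.dist b a + T.dist a x := hT.connected.dist_triangle
  rw [dist_eq_one_iff_adj.mpr ha.symm] at h2
  have h3 : T.dist y a = T.dist a y := dist_comm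
  have h4 : T.dist y x = T.dist x y := dist_comm
  omega

theorem IsTree.stepToward_of_adj (hT : T.IsTree) (h : T.Adj x y) : T.stepToward x y = y :=
  (hT.eq_stepToward h (by rw [dist_self, dist_eq_one_iff_adj.mpr h])).symm

theorem IsTree.stepToward_ne_of_dist_lt (hT : T.IsTree) (hxy : x ≠ y)
    (h : T.dist x y < T.dist z y) : T.stepToward x y ≠ z := by
  rintro rfl
  have := hT.dist_stepToward hxy
  omega

/-- If the geodesics from `y` to `x` and to `z` start differently, then their union is a
geodesic from `x` to `z`. -/
theorem IsTree.geodesic_concat (hT : T.IsTree) (hxy : x ≠ y)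
    (hne : T.stepToward y x ≠ T.stepToward y z) :
    T.dist x z = T.dist x y + T.dist y z ∧ T.stepToward x z = T.stepToward x y := by
  induction hn : T.dist x y generalizing x with
  | zero => exact absurd (hT.connected.dist_eq_zero_iff.mp hn) hxy
  | succ n ih =>
    have ha := hT.adj_stepToward hxy
    have hd := hT.dist_stepToward hxy
    set a := T.stepToward x y with ha_def
    by_cases hay : a = y
    · have hyx : x = T.stepToward y x :=
        hT.eq_stepToward (hay ▸ ha.symm) (by
          rw [dist_self, dist_eq_one_iff_adj.mpr (hay ▸ ha.symm)])
      have h1 := hT.dist_eq_add_one_of_ne_stepToward (hay ▸ ha.symm) (by rwa [← hyx] at hne)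
      have hn0 : n = 0 := by rw [hay, dist_self] at hd; omega
      refine ⟨by omega, ?_⟩
      rw [hay]
      exact (hT.eq_stepToward (hay ▸ ha) h1.symm).symm
    · obtain ⟨h1, h2⟩ := ih hay (by rwa [hT.stepToward_stepToward hxy hay]) (by omega)
      have hxa : x ≠ T.stepToward a z := by
        rw [h2]
        intro h
        have := hT.dist_stepToward hay
        rw [← h] at this
        omega
      have h3 := hT.dist_eq_add_one_of_ne_stepToward ha.symm hxa
      exact ⟨by omega, (hT.eq_stepToward ha h3.symm).symm⟩

section Action

variable {G : Type*} [Group G] [MulAction G V]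

theorem dist_smul_smul (hadj : ∀ (g : G) (x y : V), T.Adj x y → T.Adj (g • x) (g • y))
    (hT : T.Connected) (g : G) (x y : V) : T.dist (g • x) (g • y) = T.dist x y := by
  have key : ∀ (g : G) (x y : V), T.dist (g • x) (g • y) ≤ T.dist x y := by
    intro g x y
    obtain ⟨p, hp⟩ := hT.exists_walk_length_eq_dist x y
    let φ : T →g T := ⟨fun v => g • v, fun h => hadj g _ _ h⟩
    rw [← hp, ← Walk.length_map φ p]
    exact dist_le _
  refine le_antisymm (key g x y) ?_
  simpa using key g⁻¹ (g • x) (g • y)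

theorem IsTree.smul_stepToward (hT : T.IsTree)
    (hadj : ∀ (g : G) (x y : V), T.Adj x y → T.Adj (g • x) (g • y)) (g : G) (h : x ≠ y) :
    g • T.stepToward x y = T.stepToward (g • x) (g • y) := by
  refine hT.eq_stepToward (hadj g _ _ (hT.adj_stepToward h)) ?_
  rw [dist_smul_smul hadj hT.connected, dist_smul_smul hadj hT.connected, hT.dist_stepToward h]

/-- A group element fixing the ends of a geodesic fixes its second vertex. -/
theorem IsTree.smul_stepToward_of_fixed (hT : T.IsTree)
    (hadj : ∀ (g : G) (x y : V), T.Adj x y → T.Adj (g • x) (g • y)) {g : G}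
    (hx : g • x = x) (hy : g • y = y) (h : x ≠ y) :
    g • T.stepToward x y = T.stepToward x y := by
  rw [hT.smul_stepToward hadj g h, hx, hy]

theorem IsTree.stepToward_pow_of_ne (hT : T.IsTree)
    (hadj : ∀ (g : G) (x y : V), T.Adj x y → T.Adj (g • x) (g • y)) {s : G} {v : V}
    (hv : s • v ≠ v) (hne : T.stepToward v (s • v) ≠ T.stepToward v (s⁻¹ • v)) (m : ℕ) :
    T.dist v (s • v) ≤ T.dist v (s ^ (m + 1) • v) ∧
      T.stepToward v (s ^ (m + 1) • v) = T.stepToward v (s • v) := by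
  induction m with
  | zero => simp
  | succ m ih =>
    have hv' : s⁻¹ • v ≠ v := fun h => hv (by rw [← h, smul_inv_smul, h])
    obtain ⟨h1, h2⟩ := hT.geodesic_concat (z := s ^ (m + 1) • v) hv' (by rw [ih.2]; exact hne.symm)
    have h3 := dist_smul_smul hadj hT.connected s (s⁻¹ • v) (s ^ (m + 1) • v)
    have h4 := dist_smul_smul hadj hT.connected s (s⁻¹ • v) v
    rw [smul_smul s (s ^ (m + 1)), ← pow_succ', smul_inv_smul] at h3
    rw [smul_inv_smul] at h4
    refine ⟨by omega, ?_⟩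
    have h5 : s⁻¹ • v ≠ s ^ (m + 1) • v := by
      intro h
      rw [h, dist_self, ← h] at h1
      exact hv' (hT.connected.dist_eq_zero_iff.mp (by omega))
    have h6 := hT.smul_stepToward hadj s h5
    rw [h2, hT.smul_stepToward hadj s hv', smul_smul s (s ^ (m + 1)), ← pow_succ',
      smul_inv_smul] at h6
    exact h6.symm

/-- An automorphism `s` of a tree without fixed vertices and inversions moves every vertex `v`
further by its powers, in the direction of `s • v` or of `s⁻¹ • v`. -/
theorem IsTree.stepToward_zpow (hT : T.IsTree)
    (hadj : ∀ (g : G) (x y : V), T.Adj x y → T.Adj (g • x) (g • y)) {s : G}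
    (hfix : ∀ v : V, s • v ≠ v) (hinv : ∀ x y : V, T.Adj x y → s • x = y → s • y ≠ x)
    (v : V) (m : ℤ) (hm : m ≠ 0) :
    T.dist v (s • v) ≤ T.dist v (s ^ m • v) ∧
      (T.stepToward v (s ^ m • v) = T.stepToward v (s • v) ∨
        T.stepToward v (s ^ m • v) = T.stepToward v (s⁻¹ • v)) := by
  induction hN : T.dist v (s • v) using Nat.strong_induction_on generalizing v m with
  | _ N ih =>
  have hv := hfix v
  have hv' : s⁻¹ • v ≠ v := fun h => hv (by rw [← h, smul_inv_smul, h])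
  have hdinv : T.dist v (s⁻¹ • v) = T.dist v (s • v) := by
    rw [← dist_smul_smul hadj hT.connected s v (s⁻¹ • v), smul_inv_smul, dist_comm]
  by_cases hne : T.stepToward v (s • v) = T.stepToward v (s⁻¹ • v)
  · set a := T.stepToward v (s • v) with ha_def
    have ha := hT.adj_stepToward hv.symm
    have had := hT.dist_stepToward hv.symm
    rw [← ha_def] at ha had
    have hsa : T.stepToward (s • v) v = s • a := by
      rw [hne, hT.smul_stepToward hadj s hv'.symm, smul_inv_smul]
    have hav : a ≠ s • v := fun h => hinv v a ha h.symm (by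
      rw [← hsa, ← h, hT.stepToward_of_adj ha.symm])
    have hda : T.dist a (s • a) + 2 = T.dist v (s • v) := by
      have h1 := hT.dist_stepToward hav.symm
      rw [hT.stepToward_stepToward hv.symm hav, hsa, dist_comm, dist_comm (u := s • v)] at h1
      omega
    have hdva : T.dist v (s⁻¹ • a) = T.dist a (s • v) := by
      rw [← dist_smul_smul hadj hT.connected s v (s⁻¹ • a), smul_inv_smul, dist_comm]
    have hdaa : T.dist a (s⁻¹ • a) = T.dist a (s • a) := by
      rw [← dist_smul_smul hadj hT.connected s a (s⁻¹ • a), smul_inv_smul, dist_comm]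
    have hva : T.dist v (s • v) ≤ T.dist v (s • a) + T.dist (s • a) (s • v) :=
      hT.connected.dist_triangle
    rw [dist_smul_smul hadj hT.connected s a v, dist_eq_one_iff_adj.mpr ha.symm] at hva
    have hstep : ∀ k : ℤ, k ≠ 0 →
        T.dist a (s • a) ≤ T.dist a (s ^ k • a) ∧ T.stepToward a (s ^ k • a) ≠ v := by
      intro k hk
      obtain ⟨h1, h2⟩ := ih (T.dist a (s • a)) (by omega) a k hk rfl
      refine ⟨h1, ?_⟩
      rcases h2 with h2 | h2 <;> rw [h2]
      · exact hT.stepToward_ne_of_dist_lt (hfix a).symm (by omega)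
      · exact hT.stepToward_ne_of_dist_lt
          (fun h => hfix a (by rw [h, smul_inv_smul, ← h])) (by omega)
    have hne_m : a ≠ s ^ m • a := by
      intro h
      have h1 := (hstep m hm).1
      rw [← h, dist_self] at h1
      exact hfix a (hT.connected.dist_eq_zero_iff.mp (by omega)).symm
    obtain ⟨h1, h2⟩ := hT.geodesic_concat (z := s ^ m • a) ha.ne
      (by rw [hT.stepToward_of_adj ha.symm]; exact (hstep m hm).2.symm)
    rw [hT.stepToward_of_adj ha] at h2
    rw [dist_eq_one_iff_adj.mpr ha] at h1
    have hvm : v ≠ s ^ m • a := by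
      intro h
      rw [← h, dist_self] at h1
      omega
    obtain ⟨h3, h4⟩ := hT.geodesic_concat (z := s ^ m • v) hvm (by
      have h5 := hT.stepToward_stepToward hvm (by rwa [h2])
      have h6 := (hstep (-m) (neg_ne_zero.mpr hm)).2
      rw [zpow_neg] at h6
      have h7 : a ≠ (s ^ m)⁻¹ • a := fun h => hne_m (by rw [eq_inv_smul_iff.mp h])
      rw [← h5, h2, hT.stepToward_of_adj (hadj (s ^ m) _ _ ha.symm)]
      intro h
      apply h6
      apply MulAction.injective (s ^ m)
      change _ • _ = _ • _
      rw [← h, hT.smul_stepToward hadj _ h7, smul_inv_smul])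
    rw [dist_smul_smul hadj hT.connected, dist_eq_one_iff_adj.mpr ha.symm] at h3
    have := (hstep m hm).1
    exact ⟨by omega, Or.inl (by rw [h4, h2])⟩
  · rcases Int.lt_or_gt_of_ne hm with h | h
    · obtain ⟨k, rfl⟩ : ∃ k : ℕ, m = -(k + 1 : ℕ) := ⟨(-m - 1).toNat, by omega⟩
      have := hT.stepToward_pow_of_ne hadj hv' (by rw [inv_inv]; exact Ne.symm hne) k
      rw [zpow_neg, zpow_natCast, ← inv_pow]
      exact ⟨by omega, Or.inr this.2⟩
    · obtain ⟨k, rfl⟩ : ∃ k : ℕ, m = (k + 1 : ℕ) := ⟨(m - 1).toNat, by omega⟩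
      have := hT.stepToward_pow_of_ne hadj hv hne k
      rw [zpow_natCast]
      exact ⟨by omega, Or.inl this.2⟩

/-- The elements of `G` which move a vertex `o` along a concatenation of geodesics without
backtracking, each of which is a translate of `[o, w • o]` with `w ∈ W`. -/
inductive UnfoldedProduct (T : SimpleGraph V) (o : V) (W : Set G) : G → Prop
  | of_fixed (g : G) (hg : g • o = o) : UnfoldedProduct T o W g
  | mul (k w y : G) (hk : k • o = o) (hw : w ∈ W) (hy : UnfoldedProduct T o W y)
      (h : y • o = o ∨ T.stepToward o (w⁻¹ • o) ≠ T.stepToward o (y • o)) :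
      UnfoldedProduct T o W (k * w * y)

namespace UnfoldedProduct

variable {o : V} {W : Set G} {x : G}

theorem fixed_mul {k : G} (hk : k • o = o) (hx : UnfoldedProduct T o W x) :
    UnfoldedProduct T o W (k * x) := by
  cases hx with
  | of_fixed _ hg => exact of_fixed _ (by rw [mul_smul, hg, hk])
  | mul k' w y hk' hw hy h =>
    have := mul (k * k') w y (by rw [mul_smul, hk', hk]) hw hy h
    simpa only [mul_assoc] using this

theorem dist_mul (hT : T.IsTree)
    (hadj : ∀ (g : G) (x y : V), T.Adj x y → T.Adj (g • x) (g • y)) {k w y : G}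
    (hk : k • o = o) (hw : w • o ≠ o)
    (h : y • o = o ∨ T.stepToward o (w⁻¹ • o) ≠ T.stepToward o (y • o)) :
    T.dist o (w • o) ≤ T.dist o ((k * w * y) • o) ∧
      T.stepToward o ((k * w * y) • o) = k • T.stepToward o (w • o) := by
  rw [hT.smul_stepToward hadj k hw.symm, hk]
  have h0 := dist_smul_smul hadj hT.connected k o (w • o)
  rw [hk] at h0
  rw [mul_smul, mul_smul]
  rcases h with h | h
  · rw [h]
    exact ⟨h0.ge, rfl⟩
  · have hw' : w⁻¹ • o ≠ o := fun h => hw (by rw [← h, smul_inv_smul, h])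
    obtain ⟨h1, h2⟩ := hT.geodesic_concat hw' h
    have h3 := dist_smul_smul hadj hT.connected (k * w) (w⁻¹ • o) (y • o)
    have h4 := dist_smul_smul hadj hT.connected (k * w) (w⁻¹ • o) o
    rw [mul_smul, mul_smul, smul_inv_smul, hk] at h3 h4
    refine ⟨by omega, ?_⟩
    have hne : w⁻¹ • o ≠ y • o := by
      intro h
      rw [h, dist_self, ← h] at h1
      exact hw' (hT.connected.dist_eq_zero_iff.mp (by omega))
    have h5 := hT.smul_stepToward hadj (k * w) hne
    rw [h2, hT.smul_stepToward hadj (k * w) hw', mul_smul, mul_smul, mul_smul, smul_inv_smul,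
      hk] at h5
    exact h5.symm

theorem fixed_or_le_dist (hT : T.IsTree)
    (hadj : ∀ (g : G) (x y : V), T.Adj x y → T.Adj (g • x) (g • y)) {n : ℕ} (hn : 0 < n)
    (hW : ∀ w ∈ W, n ≤ T.dist o (w • o)) (hx : UnfoldedProduct T o W x) :
    x • o = o ∨ n ≤ T.dist o (x • o) := by
  cases hx with
  | of_fixed _ hg => exact Or.inl hg
  | mul k w y hk hw hy h =>
    refine Or.inr ((hW w hw).trans (dist_mul hT hadj hk ?_ h).1)
    intro h
    have := hW w hw
    rw [h, dist_self] at this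
    omega

theorem mem_mul_fixed_mul (hT : T.IsTree)
    (hadj : ∀ (g : G) (x y : V), T.Adj x y → T.Adj (g • x) (g • y))
    (hW : ∀ w ∈ W, w • o ≠ o)
    (hfold : ∀ w ∈ W, ∀ w' ∈ W, ∀ k : G, k • o = o →
      T.stepToward o (w⁻¹ • o) = k • T.stepToward o (w' • o) →
      (w * k * w') • o = o ∨ ∃ a, ∃ v ∈ W, ∃ b, a • o = o ∧ b • o = o ∧ w * k * w' = a * v * b)
    (hx : UnfoldedProduct T o W x) (w : G) (hw : w ∈ W) (g : G) (hg : g • o = o) :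
    UnfoldedProduct T o W (w * (g * x)) := by
  induction hx generalizing w g with
  | of_fixed b hb =>
    have := mul (T := T) 1 w (g * b) (one_smul G o) hw (of_fixed _ (by rw [mul_smul, hb, hg]))
      (Or.inl (by rw [mul_smul, hb, hg]))
    simpa using this
  | mul k v y hk hv hy h ih =>
    have hgk : (g * k) • o = o := by rw [mul_smul, hk, hg]
    have hd := (dist_mul hT hadj hgk (hW v hv) h).2
    by_cases hf : T.stepToward o (w⁻¹ • o) = (g * k) • T.stepToward o (v • o)
    · rcases hfold w hw v hv (g * k) hgk hf with h1 | ⟨a, u, hu, b, ha, hb, h1⟩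
      · have := fixed_mul h1 hy
        simpa only [mul_assoc] using this
      · have := fixed_mul ha (ih u hu b hb)
        rw [← mul_assoc u b, ← mul_assoc, ← mul_assoc, ← h1] at this
        simpa only [mul_assoc] using this
    · have := mul 1 w (g * (k * v * y)) (one_smul G o) hw (fixed_mul hg (mul k v y hk hv hy h))
        (Or.inr (by
          rw [← mul_assoc, ← mul_assoc, hd]
          exact hf))
      simpa only [one_mul] using this

/-- A ping-pong argument: if backtracking at `o` between `W`-translates of `o` can only occur when
the corresponding product simplifies, then everything generated by `W` and the stabilizer of `o`
is an unfolded product. -/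
theorem of_closure_eq_top (hT : T.IsTree)
    (hadj : ∀ (g : G) (x y : V), T.Adj x y → T.Adj (g • x) (g • y))
    (hW : ∀ w ∈ W, w • o ≠ o) (hWinv : ∀ w ∈ W, w⁻¹ ∈ W)
    (hfold : ∀ w ∈ W, ∀ w' ∈ W, ∀ k : G, k • o = o →
      T.stepToward o (w⁻¹ • o) = k • T.stepToward o (w' • o) →
      (w * k * w') • o = o ∨ ∃ a, ∃ v ∈ W, ∃ b, a • o = o ∧ b • o = o ∧ w * k * w' = a * v * b)
    (hgen : Subgroup.closure ({g : G | g • o = o} ∪ W) = ⊤) (x : G) :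
    UnfoldedProduct T o W x := by
  have hx : x ∈ Subgroup.closure ({g : G | g • o = o} ∪ W) := hgen ▸ Subgroup.mem_top x
  induction hx using Subgroup.closure_induction_left with
  | one => exact of_fixed 1 (one_smul G o)
  | mul_left y hy z _ ih =>
    rcases hy with hy | hy
    · exact fixed_mul hy ih
    · simpa using mem_mul_fixed_mul hT hadj hW hfold ih y hy 1 (one_smul G o)
  | inv_mul_cancel y hy z _ ih =>
    rcases hy with hy | hy
    · exact fixed_mul (inv_smul_eq_iff.mpr (Eq.symm hy)) ih
    · simpa using mem_mul_fixed_mul hT hadj hW hfold ih y⁻¹ (hWinv y hy) 1 (one_smul G o)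

end UnfoldedProduct

/-- Let `G` act on a tree without inversions, generated by the stabilizer of a vertex `o` and an
element `s`.  If all the elements of the stabilizer of `o` fixing the first edge of one of the
geodesics `[o, s • o]`, `[o, s⁻¹ • o]` fix the whole geodesic, then `s` moves `o` to a
neighbour, provided some element does. -/
theorem IsTree.adj_smul_of_closure_eq_top (hT : T.IsTree)
    (hadj : ∀ (g : G) (x y : V), T.Adj x y → T.Adj (g • x) (g • y))
    (hinv : ∀ (g : G) (x y : V), T.Adj x y → g • x = y → g • y ≠ x) {o : V} {s : G}
    (hs : ∀ k : G, k • o = o → ∀ v : V, (s * k) • v ≠ v)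
    (hgen : ∀ N : Subgroup G, (∀ g : G, g • o = o → g ∈ N) → s ∈ N → N = ⊤)
    (hstab : ∀ k : G, k • o = o →
      k • T.stepToward o (s • o) = T.stepToward o (s • o) → k • s • o = s • o)
    (hstab_inv : ∀ k : G, k • o = o →
      k • T.stepToward o (s⁻¹ • o) = T.stepToward o (s⁻¹ • o) → k • s⁻¹ • o = s⁻¹ • o)
    (hex : ∃ g : G, T.Adj o (g • o)) : T.Adj o (s • o) := by
  have hso : s • o ≠ o := by simpa using hs 1 (one_smul G o) o
  have hso' : s⁻¹ • o ≠ o := fun h => hso (by rw [← h, smul_inv_smul, h])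
  have hdinv : T.dist o (s⁻¹ • o) = T.dist o (s • o) := by
    rw [← dist_smul_smul hadj hT.connected s o (s⁻¹ • o), smul_inv_smul, dist_comm]
  by_contra hnadj
  have hd : 2 ≤ T.dist o (s • o) := hT.connected.one_lt_dist_of_ne_of_not_adj hso.symm hnadj
  obtain ⟨W, hW, hUP⟩ : ∃ W : Set G, (∀ w ∈ W, 2 ≤ T.dist o (w • o)) ∧
      ∀ x : G, UnfoldedProduct T o W x := by
    have hne : ∀ W : Set G, (∀ w ∈ W, 2 ≤ T.dist o (w • o)) → ∀ w ∈ W, w • o ≠ o := by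
      intro W hW w hw h
      have := hW w hw
      rw [h, dist_self] at this
      omega
    by_cases hk : ∃ k : G, k • o = o ∧ k • T.stepToward o (s • o) = T.stepToward o (s⁻¹ • o)
    · obtain ⟨c, hc, hce⟩ := hk
      have hc' : c⁻¹ • o = o := inv_smul_eq_iff.mpr hc.symm
      have hro : (s * c) • o = s • o := by rw [mul_smul, hc]
      have hro' : (s * c)⁻¹ • o = c⁻¹ • s⁻¹ • o := by rw [mul_inv_rev, mul_smul]
      have hstep' : T.stepToward o ((s * c)⁻¹ • o) = T.stepToward o (s • o) := by
        have := hT.smul_stepToward hadj c⁻¹ hso'.symm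
        rw [hc', ← hce, inv_smul_smul] at this
        rw [hro', this]
      have hstab_r : ∀ k : G, k • o = o → k • T.stepToward o (s • o) = T.stepToward o (s • o) →
          k • (s * c)⁻¹ • o = (s * c)⁻¹ • o := by
        intro k hko hke
        have := hstab_inv (c * k * c⁻¹) (by rw [mul_smul, mul_smul, hc', hko, hc])
          (by rw [← hce, mul_smul, mul_smul, inv_smul_smul, hke])
        rw [mul_smul, mul_smul, ← eq_inv_smul_iff] at this
        rw [hro', this]
      generalize hr : s * c = r at *
      have hrfix : ∀ v : V, r • v ≠ v := hr ▸ hs c hc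
      have hro0 : r⁻¹ • o ≠ o := fun h => hrfix o (by rw [← h, smul_inv_smul, h])
      have hpow : ∀ m : ℤ, m ≠ 0 → T.dist o (s • o) ≤ T.dist o (r ^ m • o) ∧
          T.stepToward o (r ^ m • o) = T.stepToward o (s • o) := by
        intro m hm
        have := hT.stepToward_zpow hadj hrfix (hinv r) o m hm
        rwa [hro, hstep', or_self] at this
      -- the stabilizer of the first edge is normalized by `r`
      have hE : ∀ (m : ℤ) (k : G), k • o = o →
          k • T.stepToward o (s • o) = T.stepToward o (s • o) →
          ((r ^ m)⁻¹ * k * r ^ m) • o = o ∧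
          ((r ^ m)⁻¹ * k * r ^ m) • T.stepToward o (s • o) = T.stepToward o (s • o) := by
        intro m
        induction m with
        | zero => simpa using fun k hko hke => ⟨hko, hke⟩
        | succ i ih =>
          intro k hko hke
          obtain ⟨h1, h2⟩ := ih k hko hke
          set k' := (r ^ (i : ℤ))⁻¹ * k * r ^ (i : ℤ) with hk'
          have h3 : (r ^ ((i : ℤ) + 1))⁻¹ * k * r ^ ((i : ℤ) + 1) = r⁻¹ * k' * r := by
            rw [hk', zpow_add_one]; group
          have h4 := hstab k' h1 h2
          have h5 : (r⁻¹ * k' * r) • o = o := by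
            rw [mul_smul, mul_smul, hro, h4, ← hro, inv_smul_smul]
          have h6 : (r⁻¹ * k' * r) • r⁻¹ • o = r⁻¹ • o := by
            rw [mul_smul, smul_inv_smul, mul_smul, h1]
          rw [h3]
          refine ⟨h5, ?_⟩
          have := hT.smul_stepToward_of_fixed hadj h5 h6 hro0.symm
          rwa [hstep'] at this
        | pred i ih =>
          intro k hko hke
          obtain ⟨h1, h2⟩ := ih k hko hke
          set k' := (r ^ (-(i : ℤ)))⁻¹ * k * r ^ (-(i : ℤ)) with hk'
          have h3 : (r ^ (-(i : ℤ) - 1))⁻¹ * k * r ^ (-(i : ℤ) - 1) = r * k' * r⁻¹ := by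
            rw [hk', zpow_sub_one]; group
          have h4 := hstab_r k' h1 h2
          have h5 : (r * k' * r⁻¹) • o = o := by
            rw [mul_smul, mul_smul, h4, smul_inv_smul]
          have h6 : (r * k' * r⁻¹) • s • o = s • o := by
            rw [← hro, mul_smul, inv_smul_smul, mul_smul, h1]
          rw [h3]
          exact ⟨h5, hT.smul_stepToward_of_fixed hadj h5 h6 hso.symm⟩
      have hW : ∀ w ∈ {w : G | ∃ m : ℤ, m ≠ 0 ∧ w = r ^ m}, 2 ≤ T.dist o (w • o) := by
        rintro _ ⟨m, hm, rfl⟩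
        exact hd.trans (hpow m hm).1
      refine ⟨_, hW, UnfoldedProduct.of_closure_eq_top hT hadj (hne _ hW) ?_ ?_ ?_⟩
      · rintro _ ⟨m, hm, rfl⟩
        exact ⟨-m, neg_ne_zero.mpr hm, (zpow_neg r m).symm⟩
      · rintro _ ⟨m, hm, rfl⟩ _ ⟨m', hm', rfl⟩ k hko hke
        rw [(hpow m' hm').2, ← zpow_neg, (hpow (-m) (neg_ne_zero.mpr hm)).2] at hke
        have hk' := (hE m' k hko hke.symm).1
        have heq : r ^ m * k * r ^ m' = r ^ (m + m') * ((r ^ m')⁻¹ * k * r ^ m') := by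
          rw [zpow_add]; group
        by_cases h0 : m + m' = 0
        · left
          rw [heq, h0, zpow_zero, one_mul, hk']
        · exact Or.inr ⟨1, _, ⟨_, h0, rfl⟩, _, one_smul G o, hk', by rw [one_mul, heq]⟩
      · refine hgen _ (fun g hg => Subgroup.subset_closure (Or.inl hg)) ?_
        rw [eq_mul_inv_of_mul_eq hr]
        exact mul_mem (Subgroup.subset_closure (Or.inr ⟨1, one_ne_zero, (zpow_one r).symm⟩))
          (Subgroup.subset_closure (Or.inl hc'))
    · push Not at hk
      have hW : ∀ w ∈ ({s, s⁻¹} : Set G), 2 ≤ T.dist o (w • o) := by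
        rintro _ (rfl | rfl) <;> omega
      refine ⟨_, hW, UnfoldedProduct.of_closure_eq_top hT hadj (hne _ hW) ?_ ?_ ?_⟩
      · rintro _ (rfl | rfl) <;> simp
      · rintro _ (rfl | rfl) _ (rfl | rfl) k hko hke
        · exact absurd hke.symm (hk k hko)
        · left
          rw [mul_smul, mul_smul, hstab_inv k hko hke.symm, smul_inv_smul]
        · left
          rw [inv_inv] at hke
          rw [mul_smul, mul_smul, hstab k hko hke.symm, inv_smul_smul]
        · rw [inv_inv] at hke
          exact absurd (by rw [hke, inv_smul_smul]) (hk k⁻¹ (inv_smul_eq_iff.mpr hko.symm))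
      · exact hgen _ (fun g hg => Subgroup.subset_closure (Or.inl hg))
          (Subgroup.subset_closure (Or.inr (Or.inl rfl)))
  obtain ⟨g, hg⟩ := hex
  have h1 := dist_eq_one_iff_adj.mpr hg
  rcases (hUP g).fixed_or_le_dist hT hadj two_pos hW with h | h
  · exact hg.ne h.symm
  · omega

end Action

end SimpleGraph

namespace HNNExtension

open NormalWord SimpleGraph

section BassSerre

variable {G : Type*} [Group G] {A B : Subgroup G} (φ : A ≃* B)

/-- The exponent sum of the stable letter. -/
def exponent : HNNExtension G A B φ →* Multiplicative ℤ :=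
  lift 1 (Multiplicative.ofAdd 1) (by simp)

@[simp]
theorem exponent_of (g : G) : exponent φ (of g) = 1 := by
  simp [exponent]

@[simp]
theorem exponent_t : exponent φ t = Multiplicative.ofAdd 1 := by
  simp [exponent]

theorem exponent_t_zpow (u : ℤˣ) : exponent φ (t ^ (u : ℤ)) = Multiplicative.ofAdd (u : ℤ) := by
  rw [map_zpow, exponent_t, ← ofAdd_zsmul, smul_eq_mul, mul_one]

theorem exponent_t_zpow_ne_one (u : ℤˣ) : exponent φ (t ^ (u : ℤ)) ≠ 1 := by
  rw [exponent_t_zpow]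
  exact fun h => u.ne_zero h

/-- The vertices of the Bass–Serre tree: left cosets of the base group. -/
abbrev Vertex : Type _ :=
  HNNExtension G A B φ ⧸ (of : G →* HNNExtension G A B φ).range

variable {φ}

/-- The coset of an element. -/
abbrev vertex (z : HNNExtension G A B φ) : Vertex φ := QuotientGroup.mk z

theorem vertex_eq_iff {z z' : HNNExtension G A B φ} :
    vertex z = vertex z' ↔ ∃ g : G, z' = z * of g := by
  rw [QuotientGroup.eq]
  constructor
  · rintro ⟨g, hg⟩
    exact ⟨g, by rw [hg]; group⟩
  · rintro ⟨g, rfl⟩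
    exact ⟨g, by group⟩

@[simp]
theorem vertex_mul_of (z : HNNExtension G A B φ) (g : G) : vertex (z * of g) = vertex z :=
  (vertex_eq_iff.2 ⟨g, rfl⟩).symm

theorem smul_vertex (x z : HNNExtension G A B φ) : x • vertex z = vertex (x * z) := rfl

theorem smul_vertex_one_iff {x : HNNExtension G A B φ} :
    x • vertex (1 : HNNExtension G A B φ) = vertex 1 ↔ ∃ g : G, x = of g := by
  rw [smul_vertex, eq_comm, vertex_eq_iff]
  simp

theorem exponent_eq_one_of_smul_eq {x : HNNExtension G A B φ} {v : Vertex φ} (h : x • v = v) :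
    exponent φ x = 1 := by
  induction v using QuotientGroup.induction_on with | _ z
  obtain ⟨g, hg⟩ := vertex_eq_iff.1 h.symm
  have : exponent φ (x * z) = exponent φ (z * of g) := congrArg _ hg
  simpa [mul_comm] using this

variable (φ) in
/-- The Bass–Serre tree of an HNN-extension. -/
def tree : SimpleGraph (Vertex φ) where
  Adj x y := ∃ (z : HNNExtension G A B φ) (u : ℤˣ), x = vertex z ∧ y = vertex (z * t ^ (u : ℤ))
  symm := ⟨by
    rintro _ _ ⟨z, u, rfl, rfl⟩
    exact ⟨z * t ^ (u : ℤ), -u, rfl, by simp⟩⟩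
  loopless := ⟨by
    rintro _ ⟨z, u, rfl, h⟩
    obtain ⟨g, hg⟩ := vertex_eq_iff.1 h
    have := congrArg (exponent φ) hg
    rw [map_mul, map_mul, mul_right_inj, exponent_of] at this
    exact exponent_t_zpow_ne_one φ u this⟩

theorem tree_adj_mul (z : HNNExtension G A B φ) (u : ℤˣ) :
    (tree φ).Adj (vertex z) (vertex (z * t ^ (u : ℤ))) := ⟨z, u, rfl, rfl⟩

theorem tree_adj_vertex_iff {z : HNNExtension G A B φ} {y : Vertex φ} :
    (tree φ).Adj (vertex z) y ↔ ∃ (g : G) (u : ℤˣ), y = vertex (z * of g * t ^ (u : ℤ)) := by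
  constructor
  · rintro ⟨z', u, h, rfl⟩
    obtain ⟨g, rfl⟩ := vertex_eq_iff.1 h
    exact ⟨g, u, rfl⟩
  · rintro ⟨g, u, rfl⟩
    exact ⟨z * of g, u, by simp, rfl⟩

theorem tree_adj_smul (x : HNNExtension G A B φ) (v v' : Vertex φ) (h : (tree φ).Adj v v') :
    (tree φ).Adj (x • v) (x • v') := by
  obtain ⟨z, u, rfl, rfl⟩ := h
  exact ⟨x * z, u, rfl, by rw [smul_vertex, mul_assoc]⟩

theorem tree_no_inversion (x : HNNExtension G A B φ) (v v' : Vertex φ) (h : (tree φ).Adj v v')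
    (hx : x • v = v') : x • v' ≠ v := by
  intro hx'
  have h2 : exponent φ (x * x) = 1 :=
    exponent_eq_one_of_smul_eq (v := v) (by rw [mul_smul, hx, hx'])
  obtain ⟨z, u, rfl, rfl⟩ := h
  rw [smul_vertex] at hx
  obtain ⟨g, hg⟩ := vertex_eq_iff.1 hx
  have h1 := congrArg (exponent φ) hg
  rw [map_mul, map_mul, map_mul, exponent_of, mul_one, mul_comm, mul_left_inj] at h1
  rw [map_mul, ← h1, exponent_t_zpow] at h2
  have h3 : (u : ℤ) + u = 0 := h2
  exact u.ne_zero (by omega)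

theorem tree_reachable (x z : HNNExtension G A B φ) :
    (tree φ).Reachable (vertex z) (vertex (z * x)) := by
  induction x using induction_on generalizing z with
  | of g => simp
  | t => simpa using (tree_adj_mul z 1).reachable
  | mul x y hx hy =>
    rw [← mul_assoc]
    exact (hx z).trans (hy _)
  | inv x hx => simpa using (hx (z * x⁻¹)).symm

theorem tree_connected : (tree φ).Connected := by
  have : Nonempty (Vertex φ) := ⟨vertex 1⟩
  refine ⟨fun v v' => ?_⟩
  induction v using QuotientGroup.induction_on with | _ z
  induction v' using QuotientGroup.induction_on with | _ z'
  simpa using tree_reachable (z⁻¹ * z') z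

theorem t_zpow_mul_of (u : ℤˣ) {g : G} (hg : g ∈ toSubgroup A B u) :
    ∃ g' : G, (t ^ (u : ℤ) * of g : HNNExtension G A B φ) = of g' * t ^ (u : ℤ) := by
  rcases Int.units_eq_one_or u with rfl | rfl
  · exact ⟨φ ⟨g, hg⟩, by simpa using t_mul_of (φ := φ) ⟨g, hg⟩⟩
  · exact ⟨φ.symm ⟨g, hg⟩, by simpa using inv_t_mul_of (φ := φ) ⟨g, hg⟩⟩

theorem exists_reducedWord_of_isTrail {v v' : Vertex φ} (p : (tree φ).Walk v v')
    (hp : p.IsTrail) (z : HNNExtension G A B φ) (hz : vertex z = v) :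
    ∃ w : ReducedWord G A B, vertex (z * w.prod φ) = v' ∧ w.toList.length = p.length ∧
      ∀ y ∈ w.toList.head?, vertex (z * of w.head * t ^ (y.1 : ℤ)) = p.snd := by
  induction p generalizing z with
  | nil => exact ⟨ReducedWord.empty G A B, by simpa [ReducedWord.prod] using hz, rfl, by simp⟩
  | @cons v v₁ v' h q ih =>
    subst hz
    rw [Walk.isTrail_cons] at hp
    obtain ⟨g, u, rfl⟩ := tree_adj_vertex_iff.1 h
    obtain ⟨w, hw, hlen, hhead⟩ := ih hp.1 _ rfl
    refine ⟨⟨g, (u, w.head) :: w.toList, ?_⟩, ?_, by simpa using hlen, by simp⟩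
    · rw [List.isChain_cons]
      refine ⟨fun y hy hmem => ?_, w.chain⟩
      by_contra hne
      have hy1 : y.1 = -u := by
        rcases Int.units_eq_one_or u with rfl | rfl <;>
        rcases Int.units_eq_one_or y.1 with h | h <;> simp_all
      obtain ⟨g', hg'⟩ := t_zpow_mul_of (φ := φ) u hmem
      have hsnd := hhead y hy
      rw [hy1, mul_assoc (z * of g), hg'] at hsnd
      have hback : q.snd = vertex z := by
        rw [← hsnd, ← vertex_mul_of z (g * g')]
        simp [mul_assoc]
      have hnil : ¬ q.Nil := by
        intro hnil
        rw [Walk.length_eq_zero_iff.2 hnil, List.length_eq_zero_iff] at hlen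
        simp [hlen] at hy
      apply hp.2
      have := q.mk_start_snd_mem_edges hnil
      rw [hback] at this
      rwa [Sym2.eq_swap]
    · refine Eq.trans ?_ hw
      simp [ReducedWord.prod, mul_assoc]

theorem tree_isTree : (tree φ).IsTree := by
  refine ⟨tree_connected, fun v c hc => ?_⟩
  induction v using QuotientGroup.induction_on with | _ z
  obtain ⟨w, hw, hlen, -⟩ := exists_reducedWord_of_isTrail c hc.isTrail z rfl
  obtain ⟨g, hg⟩ := vertex_eq_iff.1 hw.symm
  have hnil := ReducedWord.toList_eq_nil_of_mem_of_range φ w ⟨g, (mul_left_cancel hg).symm⟩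
  rw [hnil] at hlen
  have := hc.three_le_length
  simp at hlen
  omega

theorem mem_toSubgroup_of_smul_eq {g : G} {u : ℤˣ}
    (h : (of g : HNNExtension G A B φ) • vertex (t ^ (u : ℤ) : HNNExtension G A B φ) =
      vertex (t ^ (u : ℤ))) :
    g ∈ toSubgroup A B (-u) := by
  by_contra hg
  rw [smul_vertex] at h
  obtain ⟨g', hg'⟩ := vertex_eq_iff.1 h.symm
  let w : ReducedWord G A B := ⟨1, [(-u, g), (u, 1)], by simp [hg]⟩
  have := ReducedWord.toList_eq_nil_of_mem_of_range φ w
    ⟨g', by simp [w, ReducedWord.prod, mul_assoc, hg']⟩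
  simp [w] at this

theorem mem_toSubgroup_of_smul_eq_of_adj {g a : G} {u : ℤˣ}
    (h : (of g : HNNExtension G A B φ) • vertex (of a * t ^ (u : ℤ) : HNNExtension G A B φ) =
      vertex (of a * t ^ (u : ℤ))) :
    a⁻¹ * g * a ∈ toSubgroup A B (-u) := by
  apply mem_toSubgroup_of_smul_eq (φ := φ)
  have := congrArg (fun v => (of a : HNNExtension G A B φ)⁻¹ • v) h
  simpa [smul_vertex, mul_assoc] using this

theorem finite_toSubgroup [Finite A] [Finite B] (u : ℤˣ) : Finite (toSubgroup A B u) := by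
  rcases Int.units_eq_one_or u with rfl | rfl
  · exact ‹Finite A›
  · exact ‹Finite B›

theorem finite_of_smul_eq [Finite A] [Finite B] {v : Vertex φ}
    (hv : (tree φ).Adj (vertex 1) v) :
    {g : G | (of g : HNNExtension G A B φ) • v = v}.Finite := by
  obtain ⟨a, u, rfl⟩ := tree_adj_vertex_iff.1 hv
  rw [one_mul]
  have := finite_toSubgroup (A := A) (B := B) (-u)
  refine Set.Finite.of_injOn (f := fun g => a⁻¹ * g * a)
    (t := (toSubgroup A B (-u) : Set G)) (fun g hg => ?_) (fun g _ g' _ h => ?_)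
    (Set.toFinite _)
  · exact mem_toSubgroup_of_smul_eq_of_adj (φ := φ) hg
  · simpa using h

theorem tree_finite_stabilizer [Finite A] [Finite B] {v v' : Vertex φ}
    (h : (tree φ).Adj v v') :
    {x : HNNExtension G A B φ | x • v = v ∧ x • v' = v'}.Finite := by
  induction v using QuotientGroup.induction_on with | _ z
  have h' := tree_adj_smul z⁻¹ _ _ h
  rw [smul_vertex, inv_mul_cancel] at h'
  refine ((finite_of_smul_eq h').image fun g => z * of g * z⁻¹).subset ?_
  rintro x ⟨hx, hx'⟩
  rw [smul_vertex] at hx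
  obtain ⟨g, hg⟩ := vertex_eq_iff.1 hx.symm
  refine ⟨g, ?_, by simp [← hg]⟩
  have hg' : (of g : HNNExtension G A B φ) = z⁻¹ * x * z := by rw [mul_assoc, hg]; simp
  rw [Set.mem_ofPred_eq, hg', mul_smul, smul_inv_smul, mul_smul, hx']

theorem card_toSubgroup (f : A ≃* B) (u : ℤˣ) : Nat.card (toSubgroup A B u) = Nat.card A := by
  rcases Int.units_eq_one_or u with rfl | rfl
  · rfl
  · exact (Nat.card_congr f.toEquiv).symm

theorem _root_.Subgroup.mem_iff_apply_mem_of_card_le {G : Type*} [Group G] {L C : Subgroup G}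
    [Finite C] {e : G → G} (he : Function.Injective e) (h : ∀ l ∈ L, e l ∈ C)
    (hcard : Nat.card C ≤ Nat.card L) (g : G) : g ∈ L ↔ e g ∈ C := by
  let F : L → C := fun l => ⟨e l, h l l.2⟩
  have hF : Function.Injective F := fun l l' hl => Subtype.ext (he (congrArg Subtype.val hl))
  have hbij := hF.bijective_of_nat_card_le hcard
  refine ⟨h g, fun hg => ?_⟩
  obtain ⟨l, hl⟩ := hbij.2 ⟨_, hg⟩
  have : (l : G) = g := he (congrArg Subtype.val hl)
  exact this ▸ l.2

/-- A subgroup of the base group of the right order which fixes an edge at the base vertex is the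
whole stabilizer of this edge. -/
theorem mem_of_smul_eq_of_card [Finite A] [Finite B] {L : Subgroup G}
    (hcard : Nat.card L = Nat.card A) {v : Vertex φ} (hv : (tree φ).Adj (vertex 1) v)
    (hL : ∀ l ∈ L, (of l : HNNExtension G A B φ) • v = v) {g : G}
    (hg : (of g : HNNExtension G A B φ) • v = v) : g ∈ L := by
  obtain ⟨a, u, rfl⟩ := tree_adj_vertex_iff.1 hv
  rw [one_mul] at hL hg
  have := finite_toSubgroup (A := A) (B := B) (-u)
  refine (Subgroup.mem_iff_apply_mem_of_card_le (e := fun g => a⁻¹ * g * a)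
    (fun _ _ h => mul_left_cancel (mul_right_cancel h))
    (fun l hl => mem_toSubgroup_of_smul_eq_of_adj (φ := φ) (hL l hl)) ?_ g).2
    (mem_toSubgroup_of_smul_eq_of_adj (φ := φ) hg)
  rw [card_toSubgroup φ, hcard]

end BassSerre

end HNNExtension

instance FreeGroup.countable {α : Type*} [Countable α] : Countable (FreeGroup α) :=
  inferInstanceAs (Countable (Quot _))

theorem Group.FG.countable {G : Type*} [Group G] (h : Group.FG G) : Countable G := by
  obtain ⟨S, _, φ, hφ⟩ := Group.fg_iff_exists_freeGroup_hom_surjective_finite.1 h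
  exact hφ.countable

/-- The fixed-point property for trees in one universe gives it for countable trees in any
other universe. -/
theorem TreeFixedPointProperty.exists_forall_smul_eq {Γ : Type*} [Group Γ]
    (h : TreeFixedPointProperty.{w} Γ) {V : Type*} [Countable V] {T : SimpleGraph V}
    (hT : T.IsTree) [MulAction Γ V]
    (hadj : ∀ (g : Γ) (x y : V), T.Adj x y → T.Adj (g • x) (g • y))
    (hinv : ∀ (g : Γ) (x y : V), T.Adj x y → g • x = y → g • y ≠ x)
    (hfin : ∀ x y : V, T.Adj x y → {g : Γ | g • x = x ∧ g • y = y}.Finite) :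
    ∃ v : V, ∀ g : Γ, g • v = v := by
  have e : V ≃ Shrink.{w} V := equivShrink.{w} V
  let I : T ≃g T.map e := SimpleGraph.Iso.map e T
  let ρ : Γ →* Equiv.Perm (Shrink.{w} V) :=
    (e.permCongrHom : Equiv.Perm V →* Equiv.Perm (Shrink.{w} V)).comp (MulAction.toPermHom Γ V)
  have hρ : ∀ (g : Γ) (x : V), ρ g (e x) = e (g • x) := fun g x => by simp [ρ]
  have hI : ∀ x y : V, (T.map e).Adj (e x) (e y) ↔ T.Adj x y := fun _ _ => I.map_adj_iff
  obtain ⟨v, hv⟩ := h (Shrink.{w} V) (T.map e) (I.isTree_iff.1 hT) ρ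
    (fun g => e.surjective.forall₂.2 fun x y hxy => by
      rw [hρ, hρ, hI]
      exact hadj g x y ((hI x y).1 hxy))
    (by
      rintro ⟨g, x, y, hxy, h1, h2⟩
      obtain ⟨x, rfl⟩ := e.surjective x
      obtain ⟨y, rfl⟩ := e.surjective y
      rw [hρ, e.apply_eq_iff_eq] at h1 h2
      exact hinv g x y ((hI x y).1 hxy) h1 h2)
    (e.surjective.forall₂.2 fun x y hxy => by
      simp only [hρ, e.apply_eq_iff_eq]
      exact hfin x y ((hI x y).1 hxy))
  obtain ⟨v, rfl⟩ := e.surjective v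
  exact ⟨v, fun g => e.injective ((hρ g v).symm.trans (hv g))⟩

namespace HNNExtension

section Generation

variable {G : Type*} [Group G] {A B : Subgroup G} {φ : A ≃* B}

theorem eq_top_of_mem {N : Subgroup (HNNExtension G A B φ)} (hof : ∀ g, of g ∈ N)
    (ht : t ∈ N) : N = ⊤ := by
  refine (Subgroup.eq_top_iff' N).2 fun x => ?_
  induction x using induction_on with
  | of g => exact hof g
  | t => exact ht
  | mul x y hx hy => exact mul_mem hx hy
  | inv x hx => exact inv_mem hx

instance [Countable G] : Countable (HNNExtension G A B φ) := by
  let F : FreeGroup (Option G) →* HNNExtension G A B φ :=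
    FreeGroup.lift fun x => x.elim t of
  have hF : F.range = ⊤ := eq_top_of_mem (fun g => ⟨FreeGroup.of (some g), by simp [F]⟩)
    ⟨FreeGroup.of none, by simp [F]⟩
  exact (MonoidHom.range_eq_top.1 hF).countable

end Generation

end HNNExtension

namespace HNNExtension

open NormalWord SimpleGraph

section Isomorphism

variable {G : Type*} [Group G] {A B A' B' : Subgroup G} {φ : A ≃* B} {φ' : A' ≃* B'}

theorem exponent_apply_t_ne_one {Ψ : HNNExtension G A B φ ≃* HNNExtension G A' B' φ'}
    {α : G ≃* G} (hΨ : ∀ g, Ψ (of g) = of (α g)) : exponent φ' (Ψ t) ≠ 1 := by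
  intro ht
  have : (exponent φ').comp Ψ.toMonoidHom = 1 :=
    hom_ext (by ext g; simp [hΨ]) (by simpa using ht)
  have h1 := DFunLike.congr_fun this (Ψ.symm t)
  simp at h1

theorem apply_t_mul_of {Ψ : HNNExtension G A B φ ≃* HNNExtension G A' B' φ'}
    {α : G ≃* G} (hΨ : ∀ g, Ψ (of g) = of (α g)) (a : A) :
    Ψ t * of (α a) = of (α (φ a)) * Ψ t := by
  rw [← hΨ, ← hΨ, ← map_mul, ← map_mul, t_mul_of]

theorem exists_vertex_fixed [Finite A] [Finite B] {Γ : Type*} [Group Γ] [Countable G]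
    (h : TreeFixedPointProperty.{w} Γ) (ρ : Γ →* HNNExtension G A B φ)
    (hρ : Function.Injective ρ) :
    ∃ z : HNNExtension G A B φ, ∀ g : Γ, ρ g • vertex z = vertex z := by
  let _ : MulAction Γ (Vertex φ) := MulAction.compHom _ ρ
  have : Countable (Vertex φ) := Quotient.countable
  obtain ⟨v, hv⟩ := h.exists_forall_smul_eq (T := tree φ) tree_isTree
    (fun g => tree_adj_smul (ρ g)) (fun g => tree_no_inversion (ρ g))
    (fun x y hxy => (tree_finite_stabilizer hxy).preimage hρ.injOn)
  induction v using QuotientGroup.induction_on with | _ z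
  exact ⟨z, hv⟩

variable [Finite A'] [Finite B']

/-- If the base group has the tree fixed-point property, an isomorphism of HNN-extensions can be
changed into one that preserves the base group. -/
theorem exists_mulEquiv_of_eq_of [Finite A] [Finite B] [Countable G]
    (h : TreeFixedPointProperty.{w} G)
    (Φ : HNNExtension G A B φ ≃* HNNExtension G A' B' φ') :
    ∃ (Ψ : HNNExtension G A B φ ≃* HNNExtension G A' B' φ') (α : G ≃* G),
      ∀ g, Ψ (of g) = of (α g) := by
  obtain ⟨x, hx⟩ := exists_vertex_fixed h (Φ.toMonoidHom.comp of)
    (Φ.injective.comp (of_injective φ))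
  let Ψ : HNNExtension G A B φ ≃* HNNExtension G A' B' φ' := Φ.trans (MulAut.conj x⁻¹)
  have hΨ : ∀ g : G, ∃ g' : G, Ψ (of g) = of g' := fun g => by
    obtain ⟨g', hg'⟩ := vertex_eq_iff.1 (hx g).symm
    exact ⟨g', by rw [eq_inv_mul_of_mul_eq hg'.symm]; simp [Ψ, mul_assoc]⟩
  choose α hα using hΨ
  let α' : G →* G := MonoidHom.mk' α fun a b => of_injective φ' (by simp [← hα])
  have hinj : Function.Injective α' := fun a b hab => by
    have : Ψ (of a) = Ψ (of b) := by rw [hα, hα]; exact congrArg of hab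
    exact of_injective φ (Ψ.injective this)
  suffices hsurj : Function.Surjective α' from
    ⟨Ψ, MulEquiv.ofBijective α' ⟨hinj, hsurj⟩, hα⟩
  obtain ⟨y, hy⟩ := exists_vertex_fixed h (Ψ.symm.toMonoidHom.comp of)
    (Ψ.symm.injective.comp (of_injective φ'))
  have hy' : ∀ g : G, ∃ g' : G, of g * Ψ y = Ψ y * of (α g') := fun g => by
    obtain ⟨g', hg'⟩ := vertex_eq_iff.1 (hy g).symm
    exact ⟨g', by simpa [hα] using congrArg Ψ hg'⟩
  by_cases hz : vertex (1 : HNNExtension G A' B' φ') = vertex (Ψ y)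
  · obtain ⟨c, hc⟩ := vertex_eq_iff.1 hz
    intro g
    obtain ⟨g', hg'⟩ := hy' (c * g * c⁻¹)
    refine ⟨g', of_injective φ' (?_ : of (α g') = of g)⟩
    rw [hc] at hg'
    simpa [mul_assoc] using hg'.symm
  · have hfix : ∀ g : G, (of g : HNNExtension G A' B' φ') •
        (tree φ').stepToward (vertex 1) (vertex (Ψ y)) =
        (tree φ').stepToward (vertex 1) (vertex (Ψ y)) := fun g =>
      tree_isTree.smul_stepToward_of_fixed tree_adj_smul (smul_vertex_one_iff.2 ⟨g, rfl⟩)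
        (by obtain ⟨g', hg'⟩ := hy' g; rw [smul_vertex, hg', vertex_mul_of]) hz
    have hfin := finite_of_smul_eq (tree_isTree.adj_stepToward hz)
    simp only [hfix] at hfin
    have : Finite G := Set.finite_univ_iff.1 hfin
    exact Finite.surjective_of_injective hinj

/-- An isomorphism which preserves the base group maps the stable letter to a product of the form
`a * t ^ (±1) * b`. -/
theorem exists_apply_t_eq {Ψ : HNNExtension G A B φ ≃* HNNExtension G A' B' φ'}
    {α : G ≃* G} (hΨ : ∀ g, Ψ (of g) = of (α g)) (hcard : Nat.card A = Nat.card A') :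
    ∃ (a b : G) (u : ℤˣ), Ψ t = of a * t ^ (u : ℤ) * of b := by
  have hmul := apply_t_mul_of hΨ
  have hone : ∀ g : G, (of g : HNNExtension G A' B' φ') • vertex (1 : HNNExtension G A' B' φ') =
    vertex 1 := fun g => smul_vertex_one_iff.2 ⟨g, rfl⟩
  have hs : ∀ k : HNNExtension G A' B' φ', k • vertex (1 : HNNExtension G A' B' φ') = vertex 1 →
      ∀ v : Vertex φ', (Ψ t * k) • v ≠ v := fun k hk v hv => by
    have := exponent_eq_one_of_smul_eq hv
    rw [map_mul, exponent_eq_one_of_smul_eq hk, mul_one] at this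
    exact exponent_apply_t_ne_one hΨ this
  have hs₁ : vertex (1 : HNNExtension G A' B' φ') ≠ Ψ t • vertex 1 := fun h => by
    simpa [← h] using hs 1 (one_smul _ _) (vertex 1)
  have hs₂ : vertex (1 : HNNExtension G A' B' φ') ≠ (Ψ t)⁻¹ • vertex 1 := fun h => by
    exact hs₁ (eq_inv_smul_iff.1 h).symm
  have key : ∀ (L : Subgroup G) (s : HNNExtension G A' B' φ'), Nat.card L = Nat.card A →
      vertex (1 : HNNExtension G A' B' φ') ≠ s • vertex 1 →
      (∀ l ∈ L, ∃ g : G, of (α l) * s = s * of g) →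
      ∀ k : HNNExtension G A' B' φ', k • vertex (1 : HNNExtension G A' B' φ') = vertex 1 →
      k • (tree φ').stepToward (vertex 1) (s • vertex 1) =
        (tree φ').stepToward (vertex 1) (s • vertex 1) →
      k • s • vertex (1 : HNNExtension G A' B' φ') = s • vertex 1 := by
    intro L s hL hne hfix k hk hk'
    have hfix' : ∀ l ∈ L, (of (α l) : HNNExtension G A' B' φ') • s • vertex (1 :
        HNNExtension G A' B' φ') = s • vertex 1 := fun l hl => by
      obtain ⟨g, hg⟩ := hfix l hl
      rw [← mul_smul, hg, mul_smul, hone]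
    obtain ⟨g, rfl⟩ := smul_vertex_one_iff.1 hk
    have hg : g ∈ L.map α.toMonoidHom := by
      refine mem_of_smul_eq_of_card ?_ (tree_isTree.adj_stepToward hne) ?_ hk'
      · rw [← hcard, ← hL]
        exact (Nat.card_congr (L.equivMapOfInjective _ α.injective).toEquiv).symm
      · rintro _ ⟨l, hl, rfl⟩
        exact tree_isTree.smul_stepToward_of_fixed tree_adj_smul (hone _) (hfix' l hl) hne
    obtain ⟨l, hl, rfl⟩ := hg
    exact hfix' l hl
  have hadj := tree_isTree.adj_smul_of_closure_eq_top (tree_adj_smul (φ := φ'))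
    tree_no_inversion hs ?_
    (key B _ (Nat.card_congr φ.toEquiv).symm hs₁ fun b hb =>
      ⟨α (φ.symm ⟨b, hb⟩), by rw [hmul, MulEquiv.apply_symm_apply]⟩)
    (key A _ rfl hs₂ fun a ha =>
      ⟨α (φ ⟨a, ha⟩), by rw [eq_inv_mul_iff_mul_eq, ← mul_assoc, hmul ⟨a, ha⟩]; simp⟩)
    ⟨t, by simpa [smul_vertex] using tree_adj_mul (1 : HNNExtension G A' B' φ') 1⟩
  · obtain ⟨a, u, hau⟩ := tree_adj_vertex_iff.1 hadj
    rw [smul_vertex, mul_one, one_mul] at hau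
    obtain ⟨b, hb⟩ := vertex_eq_iff.1 hau.symm
    exact ⟨a, b, u, hb⟩
  · intro N hN hsN
    have : N.comap Ψ.toMonoidHom = ⊤ := eq_top_of_mem
      (fun g => hN _ (by simpa [hΨ] using hone (α g))) hsN
    refine (Subgroup.eq_top_iff' N).2 fun x => ?_
    have hx : Ψ.symm x ∈ N.comap Ψ.toMonoidHom := this ▸ Subgroup.mem_top _
    simpa using hx

end Isomorphism

end HNNExtension

namespace HNNExtension

variable {G : Type*} [Group G] {H K : Subgroup G}

theorem nonempty_mulEquiv_gammaPerm {g : G} {α : G ≃* G} (hα : ∀ x : G, x ∈ H ↔ α x ∈ H)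
    (hK : ∀ x : G, x ∈ K ↔ g * α x * g⁻¹ ∈ K) (f : H ≃* K) :
    Nonempty (HNNExtension G H K f ≃*
      HNNExtension G H K (gammaPerm H K g α hα hK f)) := by
  set f' := gammaPerm H K g α hα hK f with hf'
  have hf : ∀ h : H, (f' ⟨α h, (hα h).1 h.2⟩ : G) = g * α (f h) * g⁻¹ := fun h => by
    simp [hf', gammaPerm, restrAut, conjAut]
  let F : HNNExtension G H K f →* HNNExtension G H K f' :=
    lift (of.comp α.toMonoidHom) (of g⁻¹ * t) fun h => by
      have := t_mul_of (φ := f') ⟨α h, (hα h).1 h.2⟩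
      rw [hf] at this
      simp only [map_mul] at this
      simp [mul_assoc, this]
  let F' : HNNExtension G H K f' →* HNNExtension G H K f :=
    lift (of.comp α.symm.toMonoidHom) (of (α.symm g) * t) fun h' => by
      obtain ⟨h, hh⟩ : ∃ h : H, (h' : G) = α h :=
        ⟨⟨α.symm h', (hα _).2 (by simp)⟩, by simp⟩
      obtain rfl : h' = ⟨α h, (hα h).1 h.2⟩ := Subtype.ext hh
      simp [mul_assoc, hf, t_mul_of]
  exact ⟨F.toMulEquiv F' (hom_ext (by ext; simp [F, F']) (by simp [F, F']))
    (hom_ext (by ext; simp [F, F']) (by simp [F, F']))⟩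

theorem nonempty_mulEquiv_iotaPerm {ψ : G ≃* G} {g₁ : G} (h1 : ∀ x : G, x ∈ H ↔ ψ x ∈ K)
    (h2 : ∀ x : G, x ∈ K ↔ g₁ * ψ x * g₁⁻¹ ∈ H) (f : H ≃* K) :
    Nonempty (HNNExtension G H K f ≃*
      HNNExtension G H K (iotaPerm H K ψ g₁ h1 h2 f)) := by
  set f' := iotaPerm H K ψ g₁ h1 h2 f with hf'
  have hf : ∀ h : H, ψ (f' h : G) = g₁⁻¹ * f.symm ⟨ψ h, (h1 h).1 h.2⟩ * g₁ := fun h => by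
    simp [hf', iotaPerm, restrMap, dMap]
  let F' : HNNExtension G H K f' →* HNNExtension G H K f :=
    lift (of.comp ψ.toMonoidHom) (of g₁⁻¹ * t⁻¹) fun h => by
      have := inv_t_mul_of (φ := f) ⟨ψ h, (h1 h).1 h.2⟩
      simp only at this
      simp [mul_assoc, hf, this]
  let F : HNNExtension G H K f →* HNNExtension G H K f' :=
    lift (of.comp ψ.symm.toMonoidHom) (t⁻¹ * of (ψ.symm g₁⁻¹)) fun k => by
      obtain ⟨h, hh⟩ : ∃ h : H, (f k : G) = ψ h :=
        ⟨⟨ψ.symm (f k), (h1 _).2 (by simp)⟩, by simp⟩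
      have h3 : (k : G) = g₁ * ψ (f' h) * g₁⁻¹ := by
        have : (⟨ψ h, (h1 h).1 h.2⟩ : K) = f k := Subtype.ext hh.symm
        rw [hf, this]
        simp [mul_assoc]
      have h4 := inv_t_mul_of (φ := f') (f' h)
      rw [h3, hh]
      simp only [MulEquiv.symm_apply_apply] at h4
      simp [← mul_assoc, h4]
  exact ⟨F.toMulEquiv F' (hom_ext (by ext; simp [F, F']) (by simp [F, F']))
    (hom_ext (by ext; simp [F, F']) (by simp [F, F']))⟩

theorem nonempty_mulEquiv_of_mem_gammaBar {σ : Equiv.Perm (H ≃* K)} (hσ : σ ∈ gammaBar H K)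
    (f : H ≃* K) : Nonempty (HNNExtension G H K f ≃* HNNExtension G H K (σ f)) := by
  induction hσ using Subgroup.closure_induction generalizing f with
  | mem σ hσ =>
    rcases hσ with ⟨g, α, hα, hK, rfl⟩ | ⟨ψ, g₁, h1, h2, rfl⟩
    · exact nonempty_mulEquiv_gammaPerm hα hK f
    · exact nonempty_mulEquiv_iotaPerm h1 h2 f
  | one => exact ⟨MulEquiv.refl _⟩
  | mul σ τ _ _ hσ hτ =>
    obtain ⟨e⟩ := hτ f
    obtain ⟨e'⟩ := hσ (τ f)
    exact ⟨e.trans e'⟩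
  | inv σ _ hσ =>
    obtain ⟨e⟩ := hσ (σ⁻¹ f)
    rw [show σ (σ⁻¹ f) = f from σ.apply_symm_apply f] at e
    exact ⟨e.symm⟩

/-- If `t ^ u` conjugates an element of the base group into the base group, then this element lies
in the corresponding associated subgroup. -/
theorem mem_toSubgroup_of_t_zpow_mul_of_eq {A B : Subgroup G} {φ : A ≃* B} {u : ℤˣ} {x y : G}
    (h : (t ^ (u : ℤ) * of x : HNNExtension G A B φ) = of y * t ^ (u : ℤ)) :
    x ∈ toSubgroup A B u := by
  rw [← neg_neg u]
  refine mem_toSubgroup_of_smul_eq (φ := φ) ?_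
  rw [smul_vertex, eq_comm, vertex_eq_iff]
  refine ⟨y, ?_⟩
  rw [Units.val_neg, zpow_neg, eq_inv_mul_iff_mul_eq, ← mul_assoc, h, mul_inv_cancel_right]

theorem exists_mem_gammaBar_of_mulEquiv [Countable G] (h : TreeFixedPointProperty.{w} G)
    [Finite H] [Finite K] {f f₁ : H ≃* K}
    (Φ : HNNExtension G H K f ≃* HNNExtension G H K f₁) :
    ∃ σ ∈ gammaBar H K, σ f = f₁ := by
  obtain ⟨Ψ, α, hΨ⟩ := exists_mulEquiv_of_eq_of h Φ
  obtain ⟨a, b, u, ht⟩ := exists_apply_t_eq hΨ rfl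
  have hHK : Nat.card H = Nat.card K := Nat.card_congr f.toEquiv
  let β : G ≃* G := α.trans (MulAut.conj b)
  have hβ : ∀ x, β x = b * α x * b⁻¹ := fun x => rfl
  let g : G := (b * a)⁻¹
  have hconj : ∀ x : H, (t ^ (u : ℤ) * of (β x) : HNNExtension G H K f₁) =
      of (g * β (f x) * g⁻¹) * t ^ (u : ℤ) := fun x => by
    have := apply_t_mul_of hΨ x
    rw [ht] at this
    have h3 : of (g * β (f x) * g⁻¹) = (of a⁻¹ * of (α (f x)) * of a :
        HNNExtension G H K f₁) := by
      rw [← map_mul, ← map_mul]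
      exact congrArg of (by simp [hβ, g, mul_assoc])
    rw [h3, map_inv, mul_assoc, mul_assoc, eq_inv_mul_iff_mul_eq]
    refine mul_right_cancel (b := of b) ?_
    simpa [hβ, mul_assoc] using this
  have hmem := fun x => mem_toSubgroup_of_t_zpow_mul_of_eq (hconj x)
  have hinj : Function.Injective fun x => g * β x * g⁻¹ := fun x y hxy =>
    β.injective (mul_left_cancel (mul_right_cancel hxy))
  rcases Int.units_eq_one_or u with rfl | rfl
  · have hf₁ : ∀ x : H, (f₁ ⟨β x, hmem x⟩ : G) = g * β (f x) * g⁻¹ := fun x => by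
      have := hconj x
      simp only [Units.val_one, zpow_one] at this
      rw [t_mul_of (φ := f₁) ⟨β x, hmem x⟩] at this
      exact of_injective f₁ (mul_right_cancel this)
    have hα : ∀ x : G, x ∈ H ↔ β x ∈ H :=
      Subgroup.mem_iff_apply_mem_of_card_le β.injective (fun x hx => hmem ⟨x, hx⟩) le_rfl
    have hK : ∀ x : G, x ∈ K ↔ g * β x * g⁻¹ ∈ K :=
      Subgroup.mem_iff_apply_mem_of_card_le hinj (fun x hx => by
        have := hf₁ (f.symm ⟨x, hx⟩)
        rw [MulEquiv.apply_symm_apply] at this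
        exact this ▸ SetLike.coe_mem _) le_rfl
    refine ⟨gammaPerm H K g β hα hK, Subgroup.subset_closure (Or.inl ⟨g, β, hα, hK, rfl⟩), ?_⟩
    ext x
    obtain ⟨y, rfl⟩ := (restrAut H β hα).surjective x
    exact Eq.trans (by simp [gammaPerm, conjAut]) (hf₁ y).symm
  · have hf₁ : ∀ x : H, (f₁.symm ⟨β x, hmem x⟩ : G) = g * β (f x) * g⁻¹ := fun x => by
      have := hconj x
      simp only [Units.val_neg, Units.val_one, zpow_neg, zpow_one] at this
      rw [inv_t_mul_of (φ := f₁) ⟨β x, hmem x⟩] at this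
      exact of_injective f₁ (mul_right_cancel this)
    have h1 : ∀ x : G, x ∈ H ↔ β x ∈ K :=
      Subgroup.mem_iff_apply_mem_of_card_le β.injective (fun x hx => hmem ⟨x, hx⟩) hHK.ge
    have h2 : ∀ x : G, x ∈ K ↔ g * β x * g⁻¹ ∈ H :=
      Subgroup.mem_iff_apply_mem_of_card_le hinj (fun x hx => by
        have := hf₁ (f.symm ⟨x, hx⟩)
        rw [MulEquiv.apply_symm_apply] at this
        exact this ▸ SetLike.coe_mem _) hHK.le
    refine ⟨(iotaPerm H K β g h1 h2)⁻¹,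
      inv_mem (Subgroup.subset_closure (Or.inr ⟨β, g, h1, h2, rfl⟩)), ?_⟩
    rw [Equiv.Perm.inv_eq_iff_eq]
    ext x
    have : β (iotaPerm H K β g h1 h2 f₁ x : G) =
        g⁻¹ * f₁.symm ⟨β x, hmem x⟩ * g := by
      simp [iotaPerm, restrMap, dMap]
    exact β.injective (by rw [this, hf₁]; simp [mul_assoc])

end HNNExtension

/-- For an OE-group `G₁` and finite subgroups `H`, `K`, the number of isomorphism classes of
the HNN-extensions `HNN(G₁,H,K,f)`, as `f` ranges over `Iso(H,K)`, equals the number of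
`Γ̄_{HK}`-orbits on `Iso(H,K)`. -/
theorem card_iso_classes_eq_card_gammaBar_orbits {G₁ : Type u} [Group G₁]
    (hOE : IsOEGroup.{w} G₁) (H K : Subgroup G₁) [Finite H] [Finite K] :
    Nat.card (Quot (fun f f₁ : H ≃* K => ∃ σ ∈ gammaBar H K, σ f = f₁)) =
    Nat.card (Quot (fun f f₁ : H ≃* K =>
      Nonempty (HNNExtension G₁ H K f ≃* HNNExtension G₁ H K f₁))) := by
  have h : (fun f f₁ : H ≃* K => ∃ σ ∈ gammaBar H K, σ f = f₁) = fun f f₁ : H ≃* K =>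
      Nonempty (HNNExtension G₁ H K f ≃* HNNExtension G₁ H K f₁) := by
    have := hOE.1.countable
    ext f f₁
    constructor
    · rintro ⟨σ, hσ, rfl⟩
      exact HNNExtension.nonempty_mulEquiv_of_mem_gammaBar hσ f
    · rintro ⟨Φ⟩
      exact HNNExtension.exists_mem_gammaBar_of_mulEquiv hOE.2.2 Φ
  rw [h]
end

section
/- Let G be a group and N a normal subgroup of G. If both N and the quotient group G/N have the tree fixed-point property, then G has the tree fixed-point property. -/
universe u w

/-- In an acyclic graph, a graph endomorphism that is injective and fixes both endpoints of a path
fixes every vertex of the path. -/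
theorem SimpleGraph.IsAcyclic.apply_eq_of_mem_support_of_isPath {V : Type*} {T : SimpleGraph V}
    (hT : T.IsAcyclic) (f : T →g T) (hf : Function.Injective f) {u v : V} (hu : f u = u)
    (hv : f v = v) {p : T.Walk u v} (hp : p.IsPath) {x : V} (hx : x ∈ p.support) : f x = x := by
  have hq : ((p.map f).copy hu hv).IsPath := by
    simpa using hp.map hf
  have h : (p.map f).copy hu hv = p :=
    congrArg Subtype.val ((hT.subsingleton_path u v).elim ⟨_, hq⟩ ⟨p, hp⟩)
  have hs : p.support.map f = p.support.map id := by
    simpa using congrArg SimpleGraph.Walk.support h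
  exact List.map_inj_left.mp hs x hx

/-- The common fixed vertices of a family of injective endomorphisms of a tree span a tree, as soon
as there is one. -/
theorem SimpleGraph.IsTree.induce_fixedPoints {V ι : Type*} {T : SimpleGraph V} (hT : T.IsTree)
    (f : ι → T →g T) (hf : ∀ i, Function.Injective (f i)) (hne : ∃ v, ∀ i, f i v = v) :
    (T.induce {v | ∀ i, f i v = v}).IsTree := by
  obtain ⟨v₀, hv₀⟩ := hne
  have : Nonempty {v | ∀ i, f i v = v} := ⟨⟨v₀, hv₀⟩⟩
  refine ⟨⟨fun ⟨u, hu⟩ ⟨v, hv⟩ => ?_⟩, hT.isAcyclic.induce _⟩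
  obtain ⟨p, hp, -⟩ := hT.existsUnique_path u v
  exact ⟨p.induce _ fun x hx i =>
    hT.isAcyclic.apply_eq_of_mem_support_of_isPath (f i) (hf i) (hu i) (hv i) hp hx⟩

/-- The action of `G` on the points fixed by a normal subgroup `N`. -/
def MonoidHom.permFixedPoints {G V : Type*} [Group G] (N : Subgroup G) [hN : N.Normal]
    (ρ : G →* Equiv.Perm V) : G →* Equiv.Perm {v | ∀ n : N, ρ n v = v} where
  toFun g := (ρ g).subtypePerm fun v => by
    have key (g : G) (v : V) (hv : ∀ n : N, ρ n v = v) (n : N) : ρ n (ρ g v) = ρ g v := by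
      have := hv ⟨g⁻¹ * n * g, by simpa using hN.conj_mem n n.2 g⁻¹⟩
      simpa [Equiv.symm_apply_eq] using this
    exact ⟨fun h => by simpa using key g⁻¹ _ h, key g v⟩
  map_one' := by ext; simp
  map_mul' _ _ := by ext; simp only [map_mul]; rfl

/-- If a normal subgroup `N` of `G` and the quotient `G/N` both have the tree fixed-point
property, then so does `G`. -/
theorem treeFixedPointProperty_of_normal_of_quotient {G : Type u} [Group G]
    (N : Subgroup G) [N.Normal]
    (hN : TreeFixedPointProperty.{w} N) (hQ : TreeFixedPointProperty.{w} (G ⧸ N)) :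
    TreeFixedPointProperty.{w} G := by
  intro V T hT ρ hadj hinv hfin
  let f (g : G) : T →g T := ⟨ρ g, hadj g _ _⟩
  obtain ⟨v₀, hv₀⟩ := hN V T hT (ρ.comp N.subtype) (fun n => hadj n)
    (fun ⟨n, h⟩ => hinv ⟨n, h⟩)
    (fun x y hxy => (hfin x y hxy).preimage Subtype.val_injective.injOn)
  have hF := hT.induce_fixedPoints (fun n : N => f n) (fun n => (ρ n).injective) ⟨v₀, hv₀⟩
  let σ := QuotientGroup.lift N (ρ.permFixedPoints N) fun n hn => by
    ext v
    exact v.2 ⟨n, hn⟩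
  have hfix : ∃ v, ∀ q, σ q v = v := by
    refine hQ _ _ hF σ ?_ ?_ ?_
    · rintro ⟨g⟩ x y hxy
      exact hadj g x y hxy
    · rintro ⟨⟨g⟩, x, y, hxy, hx, hy⟩
      exact hinv ⟨g, x, y, hxy, congrArg Subtype.val hx, congrArg Subtype.val hy⟩
    · intro x y hxy
      refine ((hfin x y hxy).image (QuotientGroup.mk (s := N))).subset ?_
      rintro ⟨g⟩ ⟨hx, hy⟩
      exact ⟨g, ⟨congrArg Subtype.val hx, congrArg Subtype.val hy⟩, rfl⟩
  obtain ⟨v, hv⟩ := hfix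
  exact ⟨v, fun g => congrArg Subtype.val (hv g)⟩
end

section
/- Let G be a group and H a subgroup of finite index in G. If H has the tree fixed-point property, then G has the tree fixed-point property. -/
universe u w

/-- In a tree, a vertex lying on a path from `x` to `y` and different from both is strictly
closer to any vertex `s` than the farther one of `x` and `y`. -/
theorem SimpleGraph.IsTree.dist_lt_max_dist_of_mem_support {V : Type*} {T : SimpleGraph V}
    (hT : T.IsTree) {x y z : V} {r : T.Walk x y} (hr : r.IsPath) (hz : z ∈ r.support)
    (hzx : z ≠ x) (hzy : z ≠ y) (s : V) : T.dist z s < max (T.dist x s) (T.dist y s) := by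
  classical
  have key : ∀ {a : V} (p : T.Walk s a), p.length = T.dist s a → z ∈ p.support → z ≠ a →
      T.dist z s < T.dist a s := by
    intro a p hp hzp hza
    have h1 := congrArg SimpleGraph.Walk.length (p.take_spec hzp)
    rw [SimpleGraph.Walk.length_append] at h1
    have h2 := SimpleGraph.dist_le (p.takeUntil z hzp)
    have h3 := SimpleGraph.dist_le (p.dropUntil z hzp)
    have h4 := hT.connected.pos_dist_of_ne hza
    rw [T.dist_comm (u := z), T.dist_comm (u := a)]
    omega
  obtain ⟨p, hp⟩ := hT.connected.exists_walk_length_eq_dist s x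
  obtain ⟨q, hq⟩ := hT.connected.exists_walk_length_eq_dist s y
  have huniq : r = (p.reverse.append q).bypass :=
    congrArg Subtype.val ((hT.isAcyclic.subsingleton_path x y).elim ⟨r, hr⟩
      ⟨_, (p.reverse.append q).bypass_isPath⟩)
  have hmem : z ∈ (p.reverse.append q).support :=
    SimpleGraph.Walk.support_bypass_subset_support _ (huniq ▸ hz)
  rw [SimpleGraph.Walk.mem_support_append_iff, SimpleGraph.Walk.support_reverse,
    List.mem_reverse] at hmem
  rcases hmem with h | h
  · exact lt_max_of_lt_left (key p hp h hzx)
  · exact lt_max_of_lt_right (key q hq h hzy)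

/-- In a tree, two distinct vertices minimizing the largest distance to a finite set of vertices
are adjacent. -/
theorem SimpleGraph.IsTree.adj_of_minimizes_sup_dist {V : Type*} {T : SimpleGraph V}
    (hT : T.IsTree) {S : Finset V} (hS : S.Nonempty) {x y : V}
    (hx : ∀ z, S.sup (T.dist x) ≤ S.sup (T.dist z))
    (hy : ∀ z, S.sup (T.dist y) ≤ S.sup (T.dist z)) (hxy : x ≠ y) : T.Adj x y := by
  obtain ⟨r, hr, -⟩ := hT.existsUnique_path x y
  cases r with
  | nil => exact absurd rfl hxy
  | @cons _ z _ hadj q =>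
    by_cases hzy : z = y
    · exact hzy ▸ hadj
    · obtain ⟨s, hs, hsup⟩ := S.exists_mem_eq_sup hS (T.dist z)
      have hlt := hT.dist_lt_max_dist_of_mem_support hr
        (by simp) hadj.ne' hzy s
      have h1 : T.dist x s ≤ S.sup (T.dist x) := Finset.le_sup hs
      have h2 : T.dist y s ≤ S.sup (T.dist y) := Finset.le_sup hs
      have h3 := hx z
      have h4 := hy z
      rcases lt_max_iff.mp hlt with h | h <;> omega

/-- A tree has no triangles. -/
theorem SimpleGraph.IsAcyclic.not_adj_of_adj_of_adj {V : Type*} {T : SimpleGraph V}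
    (hT : T.IsAcyclic) {x y z : V} (hxy : T.Adj x y) (hyz : T.Adj y z) : ¬ T.Adj x z := by
  intro hxz
  have h := congrArg (fun p : T.Path x z => p.1.length) ((hT.subsingleton_path x z).elim
    ⟨.cons hxy (.cons hyz .nil), by simp [hxy.ne, hyz.ne, hxz.ne]⟩
    ⟨.cons hxz .nil, by simp [hxz.ne]⟩)
  simp at h

/-- An action without inversions on a tree that preserves a nonempty finite set of vertices fixes
a vertex. -/
theorem SimpleGraph.IsTree.exists_fixed_of_finite_invariant {Γ V : Type*} [Group Γ]
    {T : SimpleGraph V} (hT : T.IsTree) (ρ : Γ →* Equiv.Perm V)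
    (hadj : ∀ (g : Γ) (x y : V), T.Adj x y → T.Adj (ρ g x) (ρ g y))
    (hinv : ¬ ∃ (g : Γ) (x y : V), T.Adj x y ∧ ρ g x = y ∧ ρ g y = x)
    {S : Finset V} (hS : S.Nonempty) (hρS : ∀ g, ∀ s ∈ S, ρ g s ∈ S) :
    ∃ v : V, ∀ g : Γ, ρ g v = v := by
  have hdist (g : Γ) (x y : V) : T.dist (ρ g x) (ρ g y) ≤ T.dist x y := by
    obtain ⟨p, hp⟩ := hT.connected.exists_walk_length_eq_dist x y
    let f : T →g T := ⟨ρ g, hadj g _ _⟩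
    exact (SimpleGraph.dist_le (p.map f)).trans_eq ((SimpleGraph.Walk.length_map f p).trans hp)
  have hsup (g : Γ) (x : V) : S.sup (T.dist (ρ g x)) ≤ S.sup (T.dist x) := by
    refine Finset.sup_le fun s hs => ?_
    calc T.dist (ρ g x) s = T.dist (ρ g x) (ρ g (ρ g⁻¹ s)) := by simp
      _ ≤ T.dist x (ρ g⁻¹ s) := hdist g _ _
      _ ≤ S.sup (T.dist x) := Finset.le_sup (hρS _ _ hs)
  have : Nonempty V := hT.connected.nonempty
  obtain ⟨x, hx⟩ : ∃ x, ∀ z, S.sup (T.dist x) ≤ S.sup (T.dist z) :=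
    ⟨_, fun z => Function.argmin_le (fun x => S.sup (T.dist x)) z⟩
  refine ⟨x, fun g => ?_⟩
  have hgx : ∀ z, S.sup (T.dist (ρ g x)) ≤ S.sup (T.dist z) := fun z => (hsup g x).trans (hx z)
  have hggx : ∀ z, S.sup (T.dist (ρ g (ρ g x))) ≤ S.sup (T.dist z) :=
    fun z => (hsup g _).trans (hgx z)
  by_contra hne
  have h1 : T.Adj x (ρ g x) := hT.adj_of_minimizes_sup_dist hS hx hgx (Ne.symm hne)
  by_cases h2 : ρ g (ρ g x) = x
  · exact hinv ⟨g, x, ρ g x, h1, rfl, h2⟩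
  · exact hT.isAcyclic.not_adj_of_adj_of_adj h1 (hadj g _ _ h1)
      (hT.adj_of_minimizes_sup_dist hS hx hggx (Ne.symm h2))

/-- A point fixed by a finite index subgroup has a finite orbit. -/
theorem Subgroup.finite_range_apply_of_finiteIndex {G V : Type*} [Group G] (H : Subgroup G)
    [H.FiniteIndex] (ρ : G →* Equiv.Perm V) {v : V} (hv : ∀ h ∈ H, ρ h v = v) :
    (Set.range fun g => ρ g v).Finite := by
  refine (Set.finite_range fun q : G ⧸ H => ρ q.out v).subset ?_
  rintro _ ⟨g, rfl⟩
  obtain ⟨h, hh⟩ := QuotientGroup.mk_out_eq_mul H g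
  exact ⟨g, by simp [hh, hv h h.2]⟩

/-- If a finite index subgroup `H` of `G` has the tree fixed-point property,
then so does `G`. -/
theorem treeFixedPointProperty_of_finiteIndex {G : Type u} [Group G]
    (H : Subgroup G) (hind : H.FiniteIndex)
    (hH : TreeFixedPointProperty.{w} H) :
    TreeFixedPointProperty.{w} G := by
  intro V T hT ρ hadj hinv hfin
  obtain ⟨v, hv⟩ := hH V T hT (ρ.comp H.subtype) (fun h => hadj h)
    (fun ⟨h, x, y, hxy⟩ => hinv ⟨h, x, y, hxy⟩)
    (fun x y hxy => (hfin x y hxy).preimage Subtype.val_injective.injOn)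
  have hO := H.finite_range_apply_of_finiteIndex ρ (v := v) fun h hh => hv ⟨h, hh⟩
  refine hT.exists_fixed_of_finite_invariant ρ hadj hinv (S := hO.toFinset)
    ⟨v, hO.mem_toFinset.mpr ⟨1, by simp⟩⟩ fun g s hs => ?_
  obtain ⟨k, rfl⟩ := hO.mem_toFinset.mp hs
  exact hO.mem_toFinset.mpr ⟨g * k, by simp⟩
end
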